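/- Let G be a finite connected simple graph with m edges, let l ≥ 1, let G_l be the l-stretch of G, and let 1 ≤ k ≤ m. Then the number of cocircuits of G_l whose crossing set has size k and contains at most one edge from the path corresponding to each edge of G is equal to l^k · N_k(G), where N_k(G) is the number of cocircuits of G of size k. -/

import Mathlib

open SimpleGraph

/-- The crossing set `δ(X,Y)` of a pair of vertex sets: the edges of `G` with one
endpoint in `X` and the other in `Y`. -/
def crossSet {V : Type*} (G : SimpleGraph V) (X Y : Set V) : Set (Sym2 V) :=
  {e | e ∈ G.edgeSet ∧ ∃ a ∈ X, ∃ b ∈ Y, e = s(a, b)}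

/-- `(X, Y)` is a cut: a partition of the vertex set into two nonempty shores. -/
def IsCutPair {V : Type*} (X Y : Set V) : Prop :=
  X.Nonempty ∧ Y.Nonempty ∧ X ∩ Y = ∅ ∧ X ∪ Y = Set.univ

/-- `(X, Y)` is a cocircuit: a cut such that no proper subset of its crossing set is
the crossing set of a cut. -/
def IsCocircuitPair {V : Type*} (G : SimpleGraph V) (X Y : Set V) : Prop :=
  IsCutPair X Y ∧ ∀ X' Y' : Set V, IsCutPair X' Y' → ¬ crossSet G X' Y' ⊂ crossSet G X Y

/-- The number of cocircuits of `G`; a cocircuit is an unordered pair of shores,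
represented as an element of `Sym2 (Set V)`. -/
noncomputable def numCocircuits {V : Type*} (G : SimpleGraph V) : ℕ :=
  Nat.card {p : Sym2 (Set V) // ∃ X Y : Set V, p = s(X, Y) ∧ IsCocircuitPair G X Y}

/-- The number of cocircuits of `G` of size `k`. -/
noncomputable def numCocircuitsOfSize {V : Type*} (G : SimpleGraph V) (k : ℕ) : ℕ :=
  Nat.card {p : Sym2 (Set V) // ∃ X Y : Set V,
    p = s(X, Y) ∧ IsCocircuitPair G X Y ∧ (crossSet G X Y).ncard = k}

/-- A convex two-colouring of `G`: both colour classes induce connected subgraphs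
(the empty induced subgraph counts as connected). -/
def ConvexTwoColouring {V : Type*} (G : SimpleGraph V) (f : V → Fin 2) : Prop :=
  (G.induce (f ⁻¹' {0})).Preconnected ∧ (G.induce (f ⁻¹' {1})).Preconnected

/-- Vertex set of the `l`-stretch of `G`: the vertices of `G` together with `l - 1`
new internal vertices for each edge of `G`. -/
abbrev StretchV {V : Type*} (G : SimpleGraph V) (l : ℕ) : Type _ :=
  V ⊕ (G.edgeSet × Fin (l - 1))

/-- The `i`-th vertex (for `0 ≤ i ≤ l`) along the path of length `l` replacing the
edge `e = ab` of `G`: it goes `a = w₀, w₁, …, w_{l-1}, w_l = b`, where `w₁, …, w_{l-1}`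
are the new internal vertices belonging to `e`. -/
def pathVert {V : Type*} (G : SimpleGraph V) (l : ℕ) (a b : V) (e : G.edgeSet)
    (i : ℕ) : StretchV G l :=
  if h : 0 < i ∧ i < l then Sum.inr (e, ⟨i - 1, by omega⟩)
  else if i = 0 then Sum.inl a else Sum.inl b

/-- The `l` edges of the `l`-stretch corresponding to the edge `e` of `G`, where the
orientation `o` chooses an ordered pair of endpoints for each edge of `G`. -/
def pathEdges {V : Type*} (G : SimpleGraph V) (l : ℕ) (o : Sym2 V → V × V)
    (e : G.edgeSet) : Set (Sym2 (StretchV G l)) :=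
  {d | ∃ i < l, d = s(pathVert G l (o e.1).1 (o e.1).2 e i,
    pathVert G l (o e.1).1 (o e.1).2 e (i + 1))}

/-- The `l`-stretch of `G`: each edge of `G` is replaced by a path with `l` edges. -/
def stretch {V : Type*} (G : SimpleGraph V) (l : ℕ) (o : Sym2 V → V × V) :
    SimpleGraph (StretchV G l) :=
  SimpleGraph.fromEdgeSet (⋃ e : G.edgeSet, pathEdges G l o e)
/-- The indices of the edges crossing from `X` to its complement, in a graph whose edges are
parameterised by `p`. -/
def cutIdx {W ι : Type*} (p : ι → Sym2 W) (X : Set W) : Set ι :=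
  {i | ∃ a ∈ X, ∃ b ∈ Xᶜ, p i = s(a, b)}

/-- `D` is the set of indices of the crossing edges of some cut. -/
def IsCutIdx {W ι : Type*} (p : ι → Sym2 W) (D : Set ι) : Prop :=
  ∃ X : Set W, X.Nonempty ∧ Xᶜ.Nonempty ∧ D = cutIdx p X

theorem mem_cutIdx {W ι : Type*} {p : ι → Sym2 W} {X : Set W} {i : ι} {u v : W}
    (h : p i = s(u, v)) : i ∈ cutIdx p X ↔ ¬(u ∈ X ↔ v ∈ X) := by
  simp only [cutIdx, Set.mem_ofPred_eq, h, Sym2.eq_iff, Set.mem_compl_iff]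
  constructor
  · rintro ⟨a, ha, b, hb, ⟨rfl, rfl⟩ | ⟨rfl, rfl⟩⟩ <;> tauto
  · intro h
    by_cases hu : u ∈ X
    · exact ⟨u, hu, v, by tauto, by simp⟩
    · exact ⟨v, by tauto, u, hu, by simp⟩

theorem cutIdx_compl {W ι : Type*} (p : ι → Sym2 W) (X : Set W) :
    cutIdx p Xᶜ = cutIdx p X := by
  ext i
  obtain ⟨u, v, h⟩ : ∃ u v, p i = s(u, v) := by
    induction h : p i with | _ u v => exact ⟨u, v, rfl⟩
  rw [mem_cutIdx h, mem_cutIdx h]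
  simp only [Set.mem_compl_iff]
  tauto

theorem isCutPair_iff {W : Type*} {X Y : Set W} :
    IsCutPair X Y ↔ Y = Xᶜ ∧ X.Nonempty ∧ Xᶜ.Nonempty := by
  constructor
  · rintro ⟨hX, hY, h1, h2⟩
    have : Y = Xᶜ := by
      refine (IsCompl.compl_eq ?_).symm
      exact ⟨Set.disjoint_iff_inter_eq_empty.2 h1, codisjoint_iff.2 h2⟩
    exact ⟨this, hX, this ▸ hY⟩
  · rintro ⟨rfl, hX, hY⟩
    exact ⟨hX, hY, by simp, by simp⟩

theorem crossSet_compl_eq_image {W ι : Type*} {H : SimpleGraph W} {p : ι → Sym2 W}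
    (hr : Set.range p = H.edgeSet) (X : Set W) :
    crossSet H X Xᶜ = p '' cutIdx p X := by
  ext e
  constructor
  · rintro ⟨he, a, ha, b, hb, rfl⟩
    rw [← hr] at he
    obtain ⟨i, hi⟩ := he
    exact ⟨i, ⟨a, ha, b, hb, hi⟩, hi⟩
  · rintro ⟨i, ⟨a, ha, b, hb, h⟩, rfl⟩
    exact ⟨hr ▸ ⟨i, rfl⟩, a, ha, b, hb, h⟩

theorem isCocircuitPair_iff {W ι : Type*} {H : SimpleGraph W} {p : ι → Sym2 W}
    (hp : Function.Injective p) (hr : Set.range p = H.edgeSet) {X Y : Set W} :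
    IsCocircuitPair H X Y ↔
      Y = Xᶜ ∧ X.Nonempty ∧ Xᶜ.Nonempty ∧ Minimal (IsCutIdx p) (cutIdx p X) := by
  unfold IsCocircuitPair
  rw [isCutPair_iff]
  constructor
  · rintro ⟨⟨rfl, hX, hY⟩, h⟩
    refine ⟨rfl, hX, hY, ⟨X, hX, hY, rfl⟩, ?_⟩
    rintro D ⟨Z, hZ, hZ', rfl⟩ hle
    by_contra hn
    refine h Z Zᶜ (isCutPair_iff.2 ⟨rfl, hZ, hZ'⟩) ?_
    rw [crossSet_compl_eq_image hr, crossSet_compl_eq_image hr]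
    exact (hp.injOn.image_ssubset_image_iff (Set.subset_univ _) (Set.subset_univ _)).2 ⟨hle, hn⟩
  · rintro ⟨rfl, hX, hY, hm⟩
    refine ⟨⟨rfl, hX, hY⟩, ?_⟩
    intro Z Z' hZ hss
    obtain ⟨rfl, h1, h2⟩ := isCutPair_iff.1 hZ
    rw [crossSet_compl_eq_image hr, crossSet_compl_eq_image hr,
      hp.injOn.image_ssubset_image_iff (Set.subset_univ _) (Set.subset_univ _)] at hss
    exact hss.2 (hm.2 ⟨Z, h1, h2, rfl⟩ hss.1)

theorem eq_or_eq_compl_of_cutIdx_eq {W ι : Type*} {H : SimpleGraph W} {p : ι → Sym2 W}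
    (hr : Set.range p = H.edgeSet)
    (hc : ∀ S : Set W, S.Nonempty → (∀ a b, H.Adj a b → a ∈ S → b ∈ S) → S = Set.univ)
    {X Z : Set W} (h : cutIdx p X = cutIdx p Z) : X = Z ∨ X = Zᶜ := by
  have key : ∀ a b, H.Adj a b → ((a ∈ X ↔ b ∈ X) ↔ (a ∈ Z ↔ b ∈ Z)) := by
    intro a b hab
    have : s(a, b) ∈ Set.range p := hr ▸ hab
    obtain ⟨i, hi⟩ := this
    have := Set.ext_iff.1 h i
    rw [mem_cutIdx hi, mem_cutIdx hi] at this
    tauto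
  by_cases hne : ({v | v ∈ X ↔ v ∈ Z} : Set W).Nonempty
  · left
    have := hc _ hne (fun a b hab ha => by
      have := key a b hab
      simp only [Set.mem_ofPred_eq] at ha ⊢
      tauto)
    ext v
    exact Set.ext_iff.1 this v |>.2 trivial
  · right
    ext v
    have : ¬(v ∈ X ↔ v ∈ Z) := fun hv => hne ⟨v, hv⟩
    rw [Set.mem_compl_iff]
    tauto

theorem card_cocircuits_eq {W ι : Type*} {H : SimpleGraph W} {p : ι → Sym2 W}
    (hp : Function.Injective p) (hr : Set.range p = H.edgeSet)
    (hc : ∀ S : Set W, S.Nonempty → (∀ a b, H.Adj a b → a ∈ S → b ∈ S) → S = Set.univ)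
    (P : Set (Sym2 W) → Prop) :
    Nat.card {q : Sym2 (Set W) // ∃ X Y : Set W,
      q = s(X, Y) ∧ IsCocircuitPair H X Y ∧ P (crossSet H X Y)} =
    Nat.card {D : Set ι // Minimal (IsCutIdx p) D ∧ P (p '' D)} := by
  symm
  have ex : ∀ D : {D : Set ι // Minimal (IsCutIdx p) D ∧ P (p '' D)},
      ∃ X : Set W, X.Nonempty ∧ Xᶜ.Nonempty ∧ D.1 = cutIdx p X := fun D => D.2.1.1
  choose f hf1 hf2 hf3 using ex
  refine Nat.card_congr (Equiv.ofBijective (fun D => ⟨s(f D, (f D)ᶜ), f D, (f D)ᶜ, rfl, ?_, ?_⟩)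
    ⟨?_, ?_⟩)
  · exact (isCocircuitPair_iff hp hr).2 ⟨rfl, hf1 D, hf2 D, hf3 D ▸ D.2.1⟩
  · rw [crossSet_compl_eq_image hr, ← hf3 D]
    exact D.2.2
  · intro D E h
    have h' : s(f D, (f D)ᶜ) = s(f E, (f E)ᶜ) := congrArg Subtype.val h
    apply Subtype.ext
    rw [hf3 D, hf3 E]
    rcases Sym2.eq_iff.1 h' with ⟨h1, -⟩ | ⟨h1, -⟩
    · rw [h1]
    · rw [h1, cutIdx_compl]
  · rintro ⟨q, X, Y, rfl, h, hP⟩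
    obtain ⟨rfl, h1, h2, hm⟩ := (isCocircuitPair_iff hp hr).1 h
    rw [crossSet_compl_eq_image hr] at hP
    refine ⟨⟨cutIdx p X, hm, hP⟩, Subtype.ext ?_⟩
    rcases eq_or_eq_compl_of_cutIdx_eq hr hc (hf3 ⟨cutIdx p X, hm, hP⟩) with h | h
    · exact congrArg (fun S => s(S, Sᶜ)) h.symm
    · change s(f _, (f _)ᶜ) = _
      rw [← h, Sym2.eq_swap, ← compl_eq_comm.1 h.symm]

theorem SimpleGraph.Connected.eq_univ_of_adj_closed {V : Type*} {G : SimpleGraph V}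
    (hG : G.Connected) (S : Set V) (hS : S.Nonempty)
    (h : ∀ a b, G.Adj a b → a ∈ S → b ∈ S) : S = Set.univ := by
  obtain ⟨u, hu⟩ := hS
  refine Set.eq_univ_of_forall fun v => ?_
  obtain ⟨w⟩ := hG.preconnected u v
  induction w with
  | nil => exact hu
  | cons hab _ ih => exact ih (h _ _ hab hu)

section Stretch

variable {V : Type*} {G : SimpleGraph V} {l : ℕ} {o : Sym2 V → V × V}

/-- The `i`-th vertex on the path replacing `e`. -/
def pathVertex (G : SimpleGraph V) (l : ℕ) (o : Sym2 V → V × V) (e : G.edgeSet) (i : ℕ) :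
    StretchV G l :=
  pathVert G l (o e.1).1 (o e.1).2 e i

/-- The `i`-th edge on the path replacing `e`. -/
def stretchEdge (G : SimpleGraph V) (l : ℕ) (o : Sym2 V → V × V) (x : G.edgeSet × Fin l) :
    Sym2 (StretchV G l) :=
  s(pathVertex G l o x.1 x.2, pathVertex G l o x.1 (x.2 + 1))

theorem pathVertex_zero (e : G.edgeSet) : pathVertex G l o e 0 = Sum.inl (o e.1).1 := by
  simp [pathVertex, pathVert]

theorem pathVertex_length (hl : 1 ≤ l) (e : G.edgeSet) :
    pathVertex G l o e l = Sum.inl (o e.1).2 := by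
  have : l ≠ 0 := by omega
  simp [pathVertex, pathVert, this]

theorem pathVertex_succ (e : G.edgeSet) (j : Fin (l - 1)) :
    pathVertex G l o e (j + 1) = Sum.inr (e, j) := by
  have := j.2
  have h : (j : ℕ) + 1 < l := by omega
  simp [pathVertex, pathVert, h]

theorem orient_ne (ho : ∀ e : G.edgeSet, s((o e.1).1, (o e.1).2) = e.1) (e : G.edgeSet) :
    (o e.1).1 ≠ (o e.1).2 := by
  have : s((o e.1).1, (o e.1).2) ∈ G.edgeSet := by rw [ho]; exact e.2
  exact G.ne_of_adj this

theorem pathVertex_ne (ho : ∀ e : G.edgeSet, s((o e.1).1, (o e.1).2) = e.1)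
    (e : G.edgeSet) (i : ℕ) (hi : i < l) :
    pathVertex G l o e i ≠ pathVertex G l o e (i + 1) := by
  have := orient_ne ho e
  unfold pathVertex pathVert
  split_ifs <;> simp_all
  omega

theorem stretchEdge_injective (ho : ∀ e : G.edgeSet, s((o e.1).1, (o e.1).2) = e.1) :
    Function.Injective (stretchEdge G l o) := by
  rintro ⟨e, i⟩ ⟨e', j⟩ h
  have hi := i.2
  have hj := j.2
  have hne := orient_ne ho e
  have hne' := orient_ne ho e'
  by_cases hl1 : l = 1
  · subst hl1
    have hi0 : i = 0 := Subsingleton.elim _ _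
    have hj0 : j = 0 := Subsingleton.elim _ _
    subst hi0 hj0
    have : e.1 = e'.1 := by
      rw [← ho e, ← ho e']
      rw [Sym2.eq_iff]
      simpa only [stretchEdge, pathVertex, pathVert, Sym2.eq_iff, Fin.val_zero, lt_irrefl,
        false_and, and_false, dite_false, if_true, zero_add, one_ne_zero, if_false,
        Sum.inl.injEq] using h
    rw [Subtype.ext this]
  · suffices e = e' ∧ (i : ℕ) = j by
      rw [this.1, Fin.ext this.2]
    simp only [stretchEdge, pathVertex, pathVert, Sym2.eq_iff] at h
    split_ifs at h <;> simp only [Sum.inr.injEq, Sum.inl.injEq, Prod.mk.injEq, Fin.mk.injEq,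
      false_and, and_false, or_false, false_or] at h <;> grind

theorem range_stretchEdge (ho : ∀ e : G.edgeSet, s((o e.1).1, (o e.1).2) = e.1) :
    Set.range (stretchEdge G l o) = (stretch G l o).edgeSet := by
  unfold stretch
  rw [edgeSet_fromEdgeSet]
  ext d
  simp only [Set.mem_range, Prod.exists, Set.mem_sdiff, Set.mem_iUnion]
  constructor
  · rintro ⟨e, i, rfl⟩
    exact ⟨⟨e, i, i.2, rfl⟩, pathVertex_ne ho e i i.2⟩
  · rintro ⟨⟨e, i, hi, rfl⟩, -⟩
    exact ⟨e, ⟨i, hi⟩, rfl⟩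

theorem stretch_eq_univ_of_adj_closed (hG : G.Connected) (hl : 1 ≤ l)
    (ho : ∀ e : G.edgeSet, s((o e.1).1, (o e.1).2) = e.1)
    (S : Set (StretchV G l)) (hS : S.Nonempty)
    (h : ∀ a b, (stretch G l o).Adj a b → a ∈ S → b ∈ S) : S = Set.univ := by
  have hstep : ∀ (e : G.edgeSet) (i : ℕ), i < l →
      (pathVertex G l o e i ∈ S ↔ pathVertex G l o e (i + 1) ∈ S) := by
    intro e i hi
    have : (stretch G l o).Adj (pathVertex G l o e i) (pathVertex G l o e (i + 1)) := by
      rw [← mem_edgeSet, ← range_stretchEdge ho]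
      exact ⟨(e, ⟨i, hi⟩), rfl⟩
    exact ⟨h _ _ this, h _ _ this.symm⟩
  have hall : ∀ (e : G.edgeSet) (i : ℕ), i ≤ l →
      (pathVertex G l o e i ∈ S ↔ Sum.inl (o e.1).1 ∈ S) := by
    intro e i
    induction i with
    | zero => intro _; rw [pathVertex_zero]
    | succ n ih => intro hn; rw [← hstep e n (by omega), ih (by omega)]
  have hinr : ∀ (e : G.edgeSet) (j : Fin (l - 1)),
      (Sum.inr (e, j) ∈ S ↔ Sum.inl (o e.1).1 ∈ S) := by
    intro e j
    rw [← hall e (j + 1) (by omega), pathVertex_succ]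
  have hV : (Sum.inl ⁻¹' S : Set V) = Set.univ := by
    apply hG.eq_univ_of_adj_closed
    · obtain ⟨v | ⟨e, j⟩, hv⟩ := hS
      · exact ⟨v, hv⟩
      · exact ⟨_, (hinr e j).1 hv⟩
    · intro a b hab ha
      have h1 := hall ⟨s(a, b), hab⟩ l le_rfl
      rw [pathVertex_length hl] at h1
      have h2 := ho ⟨s(a, b), hab⟩
      simp only [Set.mem_preimage] at *
      rcases Sym2.eq_iff.1 h2 with ⟨h3, h4⟩ | ⟨h3, h4⟩ <;> rw [h3, h4] at h1 <;> tauto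
  have hV' : ∀ v : V, Sum.inl v ∈ S := fun v => (Set.ext_iff.1 hV v).2 trivial
  refine Set.eq_univ_of_forall ?_
  rintro (v | ⟨e, j⟩)
  · exact hV' v
  · exact (hinr e j).2 (hV' _)

theorem iff_of_forall_step {f : ℕ → Prop} {m n : ℕ} (hmn : m ≤ n)
    (h : ∀ i, m ≤ i → i < n → (f i ↔ f (i + 1))) : f m ↔ f n := by
  induction n, hmn using Nat.le_induction with
  | base => rfl
  | succ n hmn ih =>
    rw [ih fun i h1 h2 => h i h1 (by omega)]
    exact h n hmn (by omega)

/-- `D` contains at most one pair over each first coordinate. -/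
def IsPartialSection {α β : Type*} (D : Set (α × β)) : Prop :=
  ∀ a i j, (a, i) ∈ D → (a, j) ∈ D → i = j

theorem mem_cutIdx_edge (ho : ∀ e : G.edgeSet, s((o e.1).1, (o e.1).2) = e.1)
    (X : Set V) (e : G.edgeSet) :
    e ∈ cutIdx (Subtype.val : G.edgeSet → Sym2 V) X ↔ ¬((o e.1).1 ∈ X ↔ (o e.1).2 ∈ X) :=
  mem_cutIdx (ho e).symm

theorem isCutIdx_fst_image (hG : G.Connected) (hl : 1 ≤ l)
    (ho : ∀ e : G.edgeSet, s((o e.1).1, (o e.1).2) = e.1)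
    {D : Set (G.edgeSet × Fin l)} (hD : IsPartialSection D)
    (h : IsCutIdx (stretchEdge G l o) D) :
    IsCutIdx (Subtype.val : G.edgeSet → Sym2 V) (Prod.fst '' D) := by
  obtain ⟨X, hX, hX', hDX⟩ := h
  have hmem : ∀ (e : G.edgeSet) (i : ℕ) (hi : i < l), (e, ⟨i, hi⟩) ∈ D ↔
      ¬(pathVertex G l o e i ∈ X ↔ pathVertex G l o e (i + 1) ∈ X) := by
    intro e i hi
    rw [hDX]
    exact mem_cutIdx rfl
  have himg : Prod.fst '' D = cutIdx (Subtype.val : G.edgeSet → Sym2 V) (Sum.inl ⁻¹' X) := by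
    ext e
    rw [mem_cutIdx_edge ho, Set.mem_preimage, Set.mem_preimage, ← pathVertex_zero (l := l),
      ← pathVertex_length hl]
    by_cases hex : ∃ i, (e, i) ∈ D
    · obtain ⟨⟨i, hi⟩, hiD⟩ := hex
      have h0 := iff_of_forall_step (f := fun i => pathVertex G l o e i ∈ X)
        (Nat.zero_le i) (fun j _ hj => by
          by_contra hn
          have := hD _ _ _ ((hmem e j (by omega)).2 hn) hiD
          simp only [Fin.mk.injEq] at this
          omega)
      have h1 := iff_of_forall_step (f := fun i => pathVertex G l o e i ∈ X)
        (show i + 1 ≤ l from hi) (fun j hj hj' => by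
          by_contra hn
          have := hD _ _ _ ((hmem e j (by omega)).2 hn) hiD
          simp only [Fin.mk.injEq] at this
          omega)
      have h2 := (hmem e i hi).1 hiD
      have h3 : e ∈ Prod.fst '' D := ⟨_, hiD, rfl⟩
      tauto
    · have h0 := iff_of_forall_step (f := fun i => pathVertex G l o e i ∈ X)
        (Nat.zero_le l) (fun j _ hj => by
          by_contra hn
          exact hex ⟨_, (hmem e j hj).2 hn⟩)
      have h3 : e ∉ Prod.fst '' D := by
        rintro ⟨⟨e', i⟩, hi, rfl⟩
        exact hex ⟨i, hi⟩
      tauto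
  have hDne : D.Nonempty := by
    by_contra hn
    rw [Set.not_nonempty_iff_eq_empty] at hn
    have := stretch_eq_univ_of_adj_closed hG hl ho X hX (fun a b hab ha => by
      rw [← mem_edgeSet, ← range_stretchEdge ho] at hab
      obtain ⟨i, hi⟩ := hab
      have hnot : i ∉ cutIdx (stretchEdge G l o) X := by rw [← hDX, hn]; simp
      rw [mem_cutIdx hi] at hnot
      tauto)
    rw [this] at hX'
    simp at hX'
  have hne : (cutIdx (Subtype.val : G.edgeSet → Sym2 V) (Sum.inl ⁻¹' X)).Nonempty :=
    himg ▸ hDne.image _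
  obtain ⟨e, a, ha, b, hb, -⟩ := hne
  exact ⟨_, ⟨a, ha⟩, ⟨b, hb⟩, himg⟩

theorem isCutIdx_of_fst_image (hl : 1 ≤ l)
    (ho : ∀ e : G.edgeSet, s((o e.1).1, (o e.1).2) = e.1)
    {D : Set (G.edgeSet × Fin l)} (hD : IsPartialSection D)
    (h : IsCutIdx (Subtype.val : G.edgeSet → Sym2 V) (Prod.fst '' D)) :
    IsCutIdx (stretchEdge G l o) D := by
  classical
  obtain ⟨X, ⟨x, hx⟩, ⟨y, hy⟩, hDX⟩ := h
  have hmem : ∀ e : G.edgeSet, (∃ i, (e, i) ∈ D) ↔ ¬((o e.1).1 ∈ X ↔ (o e.1).2 ∈ X) := by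
    intro e
    rw [← mem_cutIdx_edge ho, ← hDX]
    simp
  let φ : G.edgeSet → ℕ → Prop := fun e n =>
    if ∃ i : Fin l, (e, i) ∈ D ∧ (i : ℕ) < n then (o e.1).2 ∈ X else (o e.1).1 ∈ X
  let Z : Set (StretchV G l) := {v | Sum.elim (fun v => v ∈ X) (fun q => φ q.1 (q.2 + 1)) v}
  have hZ : ∀ (e : G.edgeSet) (n : ℕ), n ≤ l → (pathVertex G l o e n ∈ Z ↔ φ e n) := by
    intro e n hn
    rcases Nat.eq_zero_or_pos n with rfl | hn0
    · rw [pathVertex_zero]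
      simp [Z, φ]
    rcases hn.eq_or_lt with rfl | hn1
    · rw [pathVertex_length hl]
      have := hmem e
      by_cases hex : ∃ i, (e, i) ∈ D
      · simp [Z, φ, hex]
      · simp only [Z, φ, Set.mem_ofPred_eq, Sum.elim_inl, Fin.is_lt, and_true, if_neg hex]
        tauto
    · obtain ⟨n, rfl⟩ : ∃ j, n = j + 1 := ⟨n - 1, by omega⟩
      rw [show n + 1 = ((⟨n, by omega⟩ : Fin (l - 1)) : ℕ) + 1 from rfl, pathVertex_succ]
      simp [Z]
  refine ⟨Z, ⟨Sum.inl x, hx⟩, ⟨Sum.inl y, hy⟩, ?_⟩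
  ext ⟨e, i⟩
  have hcut : (e, i) ∈ cutIdx (stretchEdge G l o) Z ↔
      ¬(pathVertex G l o e i ∈ Z ↔ pathVertex G l o e (i + 1) ∈ Z) := mem_cutIdx rfl
  rw [hcut,
    hZ e i i.2.le, hZ e (i + 1) i.2]
  by_cases hex : ∃ j, (e, j) ∈ D
  · have h1 := (hmem e).1 hex
    obtain ⟨j, hj⟩ := hex
    have huniq : ∀ n : ℕ, (∃ i : Fin l, (e, i) ∈ D ∧ (i : ℕ) < n) ↔ (j : ℕ) < n := by
      intro n
      constructor
      · rintro ⟨i, hi, hin⟩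
        rwa [hD e j i hj hi]
      · exact fun hjn => ⟨j, hj, hjn⟩
    have hi : (e, i) ∈ D ↔ (i : ℕ) = j :=
      ⟨fun hi => by rw [hD e i j hi hj], fun hij => by rwa [Fin.ext hij]⟩
    simp only [φ, huniq, hi]
    rcases lt_trichotomy (i : ℕ) j with hij | hij | hij
    · have h2 : ¬ (j : ℕ) < i := by omega
      have h3 : ¬ (j : ℕ) < i + 1 := by omega
      simp [h2, h3, hij.ne]
    · simp [hij, h1]
    · have h3 : (j : ℕ) < i + 1 := by omega
      simp [hij, h3, hij.ne']
  · have h2 : ∀ n : ℕ, ¬ ∃ i : Fin l, (e, i) ∈ D ∧ (i : ℕ) < n :=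
      fun n ⟨i, hi, _⟩ => hex ⟨i, hi⟩
    have h3 : (e, i) ∉ D := fun hi => hex ⟨i, hi⟩
    simp only [φ, if_neg (h2 _), h3, not_true]

theorem minimal_isCutIdx_iff (hG : G.Connected) (hl : 1 ≤ l)
    (ho : ∀ e : G.edgeSet, s((o e.1).1, (o e.1).2) = e.1)
    {D : Set (G.edgeSet × Fin l)} (hD : IsPartialSection D) :
    Minimal (IsCutIdx (stretchEdge G l o)) D ↔
      Minimal (IsCutIdx (Subtype.val : G.edgeSet → Sym2 V)) (Prod.fst '' D) := by
  constructor
  · rintro ⟨h1, h2⟩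
    refine ⟨isCutIdx_fst_image hG hl ho hD h1, fun C hC hCD => ?_⟩
    have hsub : IsPartialSection (D ∩ Prod.fst ⁻¹' C) :=
      fun a i j hi hj => hD a i j hi.1 hj.1
    have himg : Prod.fst '' (D ∩ Prod.fst ⁻¹' C) = C := by
      rw [Set.image_inter_preimage, Set.inter_eq_right]
      exact hCD
    have := h2 (isCutIdx_of_fst_image hl ho hsub (himg.symm ▸ hC)) Set.inter_subset_left
    rintro _ ⟨x, hx, rfl⟩
    exact (this hx).2
  · rintro ⟨h1, h2⟩
    refine ⟨isCutIdx_of_fst_image hl ho hD h1, fun D' hD' hle => ?_⟩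
    have hsub : IsPartialSection D' := fun a i j hi hj => hD a i j (hle hi) (hle hj)
    have := h2 (isCutIdx_fst_image hG hl ho hsub hD') (Set.image_mono hle)
    rintro ⟨e, i⟩ hx
    obtain ⟨⟨e', j⟩, hj, rfl⟩ := this ⟨_, hx, rfl⟩
    rwa [hD _ i j hx (hle hj)]

end Stretch

theorem IsPartialSection.ncard_fst_image {α β : Type*} {D : Set (α × β)}
    (hD : IsPartialSection D) : (Prod.fst '' D).ncard = D.ncard := by
  apply Set.InjOn.ncard_image
  rintro ⟨a, i⟩ hi ⟨b, j⟩ hj hab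
  obtain rfl : a = b := hab
  rw [hD a i j hi hj]

/-- Partial sections of `Prod.fst` whose domain lies in a given family of `k`-sets are counted
by the `k`-sets together with a function on each. -/
theorem card_partialSection {α : Type*} [Finite α] (Q : Set α → Prop) (l k : ℕ) :
    Nat.card {D : Set (α × Fin l) // IsPartialSection D ∧ Q (Prod.fst '' D) ∧ D.ncard = k} =
      l ^ k * Nat.card {C : Set α // Q C ∧ C.ncard = k} := by
  classical
  have himg : ∀ (C : Set α) (σ : C → Fin l),
      Prod.fst '' {x : α × Fin l | ∃ h : x.1 ∈ C, σ ⟨x.1, h⟩ = x.2} = C := by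
    intro C σ
    ext a
    constructor
    · rintro ⟨x, ⟨h, -⟩, rfl⟩
      exact h
    · exact fun h => ⟨(a, σ ⟨a, h⟩), ⟨h, rfl⟩, rfl⟩
  have hsec : ∀ (C : Set α) (σ : C → Fin l),
      IsPartialSection {x : α × Fin l | ∃ h : x.1 ∈ C, σ ⟨x.1, h⟩ = x.2} := by
    rintro C σ a i j ⟨h, hi⟩ ⟨h', hj⟩
    exact hi.symm.trans hj
  have e : Nat.card (Σ C : {C : Set α // Q C ∧ C.ncard = k}, (C.1 → Fin l)) =
      Nat.card {D : Set (α × Fin l) //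
        IsPartialSection D ∧ Q (Prod.fst '' D) ∧ D.ncard = k} := by
    refine Nat.card_congr (Equiv.ofBijective (fun s =>
      ⟨{x : α × Fin l | ∃ h : x.1 ∈ s.1.1, s.2 ⟨x.1, h⟩ = x.2}, hsec _ _, ?_, ?_⟩) ⟨?_, ?_⟩)
    · rw [himg]
      exact s.1.2.1
    · rw [← (hsec _ _).ncard_fst_image, himg]
      exact s.1.2.2
    · rintro ⟨⟨C, hC⟩, σ⟩ ⟨⟨C', hC'⟩, σ'⟩ h
      have h' := congrArg Subtype.val h
      simp only at h'
      obtain rfl : C = C' := by rw [← himg C σ, ← himg C' σ', h']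
      obtain rfl : σ = σ' := by
        ext ⟨a, ha⟩
        obtain ⟨_, h2⟩ : (a, σ ⟨a, ha⟩) ∈
            {x : α × Fin l | ∃ h : x.1 ∈ C, σ' ⟨x.1, h⟩ = x.2} := h' ▸ ⟨ha, rfl⟩
        exact congrArg _ h2.symm
      rfl
    · rintro ⟨D, hD, hQ, hk⟩
      have hex : ∀ a : (Prod.fst '' D : Set α), ∃ i, (a.1, i) ∈ D := by
        rintro ⟨_, ⟨a, i⟩, hi, rfl⟩
        exact ⟨i, hi⟩
      choose σ hσ using hex
      refine ⟨⟨⟨Prod.fst '' D, hQ, hD.ncard_fst_image.trans hk⟩, σ⟩, Subtype.ext ?_⟩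
      ext ⟨a, i⟩
      constructor
      · rintro ⟨h, hi⟩
        exact (show σ ⟨a, h⟩ = i from hi) ▸ hσ ⟨a, h⟩
      · intro hi
        exact ⟨⟨_, hi, rfl⟩, hD a _ _ (hσ ⟨a, _⟩) hi⟩
  have := Fintype.ofFinite {C : Set α // Q C ∧ C.ncard = k}
  rw [← e, Nat.card_sigma]
  have hterm : ∀ C : {C : Set α // Q C ∧ C.ncard = k}, Nat.card (C.1 → Fin l) = l ^ k := by
    intro C
    rw [Nat.card_fun, Nat.card_fin, Nat.card_coe_set_eq, C.2.2]
  simp [hterm, mul_comm]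

theorem subsingleton_image_inter_pathEdges_iff {V : Type*} {G : SimpleGraph V} {l : ℕ}
    {o : Sym2 V → V × V} (ho : ∀ e : G.edgeSet, s((o e.1).1, (o e.1).2) = e.1)
    (D : Set (G.edgeSet × Fin l)) :
    (∀ e : G.edgeSet, (stretchEdge G l o '' D ∩ pathEdges G l o e).Subsingleton) ↔
      IsPartialSection D := by
  constructor
  · intro h e i j hi hj
    have := h e ⟨⟨_, hi, rfl⟩, i, i.2, rfl⟩ ⟨⟨_, hj, rfl⟩, j, j.2, rfl⟩
    exact congrArg Prod.snd (stretchEdge_injective ho this)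
  · rintro h e _ ⟨⟨⟨e₁, i₁⟩, h₁, rfl⟩, j₁, hj₁, hd₁⟩ _ ⟨⟨⟨e₂, i₂⟩, h₂, rfl⟩, j₂, hj₂, hd₂⟩
    have k₁ : (e₁, i₁) = (e, ⟨j₁, hj₁⟩) := stretchEdge_injective ho hd₁
    have k₂ : (e₂, i₂) = (e, ⟨j₂, hj₂⟩) := stretchEdge_injective ho hd₂
    obtain rfl : e₁ = e := congrArg Prod.fst k₁
    obtain rfl : e₂ = e₁ := congrArg Prod.fst k₂
    rw [h _ _ _ h₁ h₂]

/-- Let `G_l` be the `l`-stretch of a connected graph `G` with `m` edges and let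
`1 ≤ k ≤ m`.  The number of cocircuits of `G_l` whose crossing set has size `k` and
contains at most one edge from the path corresponding to each edge of `G` equals
`l^k · N_k(G)`. -/
theorem stmt_12 {V : Type*} [Fintype V] (G : SimpleGraph V) (hG : G.Connected)
    (l : ℕ) (hl : 1 ≤ l) (o : Sym2 V → V × V)
    (ho : ∀ e : G.edgeSet, s((o e.1).1, (o e.1).2) = e.1)
    (k : ℕ) (hk1 : 1 ≤ k) (hk2 : k ≤ G.edgeSet.ncard) :
    Nat.card {p : Sym2 (Set (StretchV G l)) // ∃ X Y : Set (StretchV G l),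
        p = s(X, Y) ∧ IsCocircuitPair (stretch G l o) X Y ∧
        (crossSet (stretch G l o) X Y).ncard = k ∧
        ∀ e : G.edgeSet,
          (crossSet (stretch G l o) X Y ∩ pathEdges G l o e).Subsingleton} =
      l ^ k * numCocircuitsOfSize G k := by
  rw [card_cocircuits_eq (stretchEdge_injective ho) (range_stretchEdge ho)
    (stretch_eq_univ_of_adj_closed hG hl ho)
    (fun C => C.ncard = k ∧ ∀ e : G.edgeSet, (C ∩ pathEdges G l o e).Subsingleton)]
  unfold numCocircuitsOfSize
  rw [card_cocircuits_eq (p := (Subtype.val : G.edgeSet → Sym2 V)) Subtype.val_injective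
    Subtype.range_val hG.eq_univ_of_adj_closed (fun C => C.ncard = k)]
  simp only [subsingleton_image_inter_pathEdges_iff ho,
    Set.ncard_image_of_injective _ (stretchEdge_injective ho),
    Set.ncard_image_of_injective _ Subtype.val_injective]
  rw [← card_partialSection]
  refine Nat.card_congr (Equiv.subtypeEquivRight fun D => ?_)
  constructor
  · rintro ⟨h1, h2, h3⟩
    exact ⟨h3, (minimal_isCutIdx_iff hG hl ho h3).1 h1, h2⟩
  · rintro ⟨h1, h2, h3⟩
    exact ⟨(minimal_isCutIdx_iff hG hl ho h1).2 h2, h3, h1⟩
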